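/- A k-linear map S : k(Δ;G^⊥) → k(Γ;F^⊥) is Σ-preserving if and only if there exists a Σ-preserving k-linear map T : k(Γ;F^⊥⊥) → k(Δ;G^⊥⊥) such that ⟨T f, g⟩ = ⟨f, S g⟩ for all f ∈ k(Γ;F^⊥⊥) and g ∈ k(Δ;G^⊥) (these pairings make sense since G^⊥⊥⊥ = G^⊥ and F^⊥⊥⊥ = F^⊥), i.e., if and only if S = T^⊥ for some Σ-preserving T. -/

import Mathlib

open Function

structure Borno (Γ : Type) where
  sets : Set (Set Γ)
  finite_mem : ∀ s : Set Γ, s.Finite → s ∈ sets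
  subset_mem : ∀ s t : Set Γ, s ⊆ t → t ∈ sets → s ∈ sets
  union_mem : ∀ s t : Set Γ, s ∈ sets → t ∈ sets → s ∪ t ∈ sets

def Borno.orth {Γ : Type} (F : Borno Γ) : Borno Γ where
  sets := {S | ∀ A ∈ F.sets, (S ∩ A).Finite}
  finite_mem := fun _ hs A _ => hs.inter_of_left A
  subset_mem := fun s t hst ht A hA =>
    (ht A hA).subset (Set.inter_subset_inter hst (subset_refl A))
  union_mem := fun s t hs ht A hA => by
    rw [Set.union_inter_distrib_right]
    exact (hs A hA).union (ht A hA)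

def bspace (k : Type) [Field k] {Γ : Type} (F : Borno Γ) : Submodule k (Γ → k) where
  carrier := {f | Function.support f ∈ F.sets}
  add_mem' := fun {f} {g} hf hg =>
    F.subset_mem _ _ (Function.support_add f g) (F.union_mem _ _ hf hg)
  zero_mem' := F.finite_mem _ (by simp)
  smul_mem' := fun c f hf =>
    F.subset_mem _ _ (Function.support_const_smul_subset c f) hf

def SummableFam {k : Type} [Field k] {Γ : Type} (F : Borno Γ) {ι : Type} (f : ι → Γ → k) : Prop :=
  (⋃ i, Function.support (f i)) ∈ F.sets ∧ ∀ γ : Γ, {i | f i γ ≠ 0}.Finite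

noncomputable def famSum {k Γ ι : Type} [Field k] (f : ι → Γ → k) : Γ → k :=
  fun γ => ∑ᶠ i, f i γ

theorem famSum_mem {k : Type} [Field k] {Γ ι : Type} (F : Borno Γ) (f : ι → Γ → k)
    (hf : SummableFam F f) : famSum f ∈ bspace k F := by
  refine F.subset_mem _ _ ?_ hf.1
  intro γ hγ
  by_contra hns
  simp only [Set.mem_iUnion, Function.mem_support] at hns
  push_neg at hns
  exact hγ (by simpa [famSum] using finsum_eq_zero_of_forall_eq_zero hns)

noncomputable def sumElem {k : Type} [Field k] {Γ ι : Type} (F : Borno Γ)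
    (f : ι → bspace k F) (hf : SummableFam F (fun i => (f i : Γ → k))) : bspace k F :=
  ⟨famSum (fun i => (f i : Γ → k)), famSum_mem F _ hf⟩

def SigmaPreserving {k : Type} [Field k] {Γ Δ : Type} {F : Borno Γ} {G : Borno Δ}
    (T : bspace k F →ₗ[k] bspace k G) : Prop :=
  ∀ (ι : Type) (f : ι → bspace k F) (hf : SummableFam F (fun i => (f i : Γ → k))),
    ∃ hg : SummableFam G (fun i => (T (f i) : Δ → k)),
      T (sumElem F f hf) = sumElem G (fun i => T (f i)) hg

noncomputable def pairing {k Γ : Type} [Field k] (f g : Γ → k) : k := ∑ᶠ γ, f γ * g γ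

noncomputable def indic {k : Type} [Field k] {Γ : Type} (F : Borno Γ) (γ : Γ) : bspace k F :=
  ⟨Set.indicator {γ} (fun _ => (1 : k)),
    F.subset_mem _ _ Set.support_indicator_subset
      (F.finite_mem _ (Set.finite_singleton γ))⟩

theorem Borno.ext_sets {Γ : Type} {E F : Borno Γ} (h : E.sets = F.sets) : E = F := by
  cases E; cases F; cases h; rfl

theorem Borno.orth_orth_orth {Γ : Type} (F : Borno Γ) : F.orth.orth.orth = F.orth := by
  have sub : ∀ E : Borno Γ, E.sets ⊆ E.orth.orth.sets := fun E A hA B hB => by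
    rw [Set.inter_comm]; exact hB A hA
  exact Borno.ext_sets (Set.Subset.antisymm (fun S hS A hA => hS A (sub F hA)) (sub F.orth))

theorem finsum_swap_of_finite {α β M : Type} [AddCommMonoid M] (f : α → β → M)
    (h : {p : α × β | f p.1 p.2 ≠ 0}.Finite) :
    ∑ᶠ a, ∑ᶠ b, f a b = ∑ᶠ b, ∑ᶠ a, f a b := by
  have h' : (support fun p : β × α => f p.2 p.1).Finite :=
    (h.image Prod.swap).subset fun p hp => ⟨p.swap, hp, Prod.swap_swap p⟩
  rw [← finsum_curry (fun p : α × β => f p.1 p.2) h,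
    ← finsum_curry (fun p : β × α => f p.2 p.1) h']
  exact finsum_eq_of_bijective Prod.swap Prod.swap_bijective fun _ => rfl

theorem pairing_comm {k Γ : Type} [Field k] (f g : Γ → k) : pairing f g = pairing g f :=
  finsum_congr fun _ => mul_comm _ _

theorem exists_ne_of_pairing_ne {k Γ : Type} [Field k] {f g : Γ → k} (h : pairing f g ≠ 0) :
    ∃ γ, f γ ≠ 0 ∧ g γ ≠ 0 := by
  by_contra! h0
  refine h (finsum_eq_zero_of_forall_eq_zero fun γ => ?_)
  by_cases hγ : f γ = 0
  · rw [hγ, zero_mul]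
  · rw [h0 γ hγ, mul_zero]

theorem indic_apply_self {k : Type} [Field k] {Γ : Type} (F : Borno Γ) (γ : Γ) :
    (indic F γ : bspace k F).1 γ = 1 := by
  simp [indic]

theorem indic_apply_ne {k : Type} [Field k] {Γ : Type} (F : Borno Γ) {γ γ' : Γ} (h : γ' ≠ γ) :
    (indic F γ : bspace k F).1 γ' = 0 := by
  simp [indic, h]

theorem pairing_indic {k : Type} [Field k] {Γ : Type} (F : Borno Γ) (γ : Γ) (g : Γ → k) :
    pairing (indic F γ : bspace k F).1 g = g γ := by
  rw [pairing, finsum_eq_single _ γ fun γ' h => by rw [indic_apply_ne F h, zero_mul],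
    indic_apply_self, one_mul]

section Adjoint

variable {k : Type} [Field k] {Γ Δ : Type} {E : Borno Γ} {H : Borno Δ}

theorem summableFam_smul_indic (g : bspace k H) :
    SummableFam H fun δ => ((g : Δ → k) δ • indic H δ : bspace k H).1 := by
  refine ⟨H.subset_mem _ _ (Set.iUnion_subset fun δ δ' h => ?_) g.2, fun δ' => ?_⟩
  · by_cases e : δ' = δ
    · subst e
      intro h0
      exact h (by simp [h0])
    · exact absurd (by simp [indic_apply_ne H e]) h
  · refine (Set.finite_singleton δ').subset fun δ h => ?_
    by_contra e
    exact h (by simp [indic_apply_ne H (Ne.symm e)])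

theorem sumElem_smul_indic (g : bspace k H) :
    sumElem H (fun δ => (g : Δ → k) δ • indic H δ) (summableFam_smul_indic g) = g := by
  ext δ'
  change ∑ᶠ δ, (g : Δ → k) δ * (indic H δ : bspace k H).1 δ' = (g : Δ → k) δ'
  rw [finsum_eq_single _ δ' fun δ h => by rw [indic_apply_ne H h.symm, mul_zero],
    indic_apply_self, mul_one]

namespace SigmaPreserving

variable {X : bspace k H →ₗ[k] bspace k E}

theorem apply_eq_finsum (hX : SigmaPreserving X) (g : bspace k H) (γ : Γ) :
    (X g : Γ → k) γ = ∑ᶠ δ, (g : Δ → k) δ * (X (indic H δ) : Γ → k) γ := by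
  obtain ⟨hg, e⟩ := hX Δ _ (summableFam_smul_indic g)
  rw [sumElem_smul_indic] at e
  rw [e]
  simp [sumElem, famSum]

theorem finite_entries (hX : SigmaPreserving X) {D : Set Δ} (hD : D ∈ H.sets)
    {M : Set Γ} (hM : M ∈ E.orth.sets) :
    {p : Δ × Γ | p.1 ∈ D ∧ p.2 ∈ M ∧ (X (indic H p.1) : Γ → k) p.2 ≠ 0}.Finite := by
  have hf : SummableFam H fun δ : D => (indic H δ.1 : bspace k H).1 := by
    refine ⟨H.subset_mem _ _ (Set.iUnion_subset fun δ δ' h => ?_) hD, fun δ' => ?_⟩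
    · by_cases e : δ' = δ
      · exact e ▸ δ.2
      · exact absurd (indic_apply_ne H e) h
    · refine Set.Finite.of_finite_image (f := Subtype.val) ((Set.finite_singleton δ').subset ?_)
        Subtype.val_injective.injOn
      rintro _ ⟨δ, h, rfl⟩
      by_contra e
      exact h (indic_apply_ne H (Ne.symm e))
  obtain ⟨⟨hU, hfin⟩, -⟩ := hX D _ hf
  refine ((hM _ hU).biUnion fun γ _ =>
    (hfin γ).image fun δ : D => (δ.1, γ)).subset ?_
  rintro ⟨δ, γ⟩ ⟨hδ, hγ, h⟩
  simp only [Set.mem_iUnion]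
  exact ⟨γ, ⟨hγ, Set.mem_iUnion.2 ⟨⟨δ, hδ⟩, h⟩⟩, ⟨δ, hδ⟩, h, rfl⟩

theorem finite_column (hX : SigmaPreserving X) {M : Set Γ} (hM : M ∈ E.orth.sets) (δ : Δ) :
    {γ | γ ∈ M ∧ (X (indic H δ) : Γ → k) γ ≠ 0}.Finite :=
  ((hX.finite_entries (H.finite_mem _ (Set.finite_singleton δ)) hM).image Prod.snd).subset
    fun γ h => ⟨(δ, γ), ⟨rfl, h⟩, rfl⟩

theorem rows_mem_orth (hX : SigmaPreserving X) {M : Set Γ} (hM : M ∈ E.orth.sets) :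
    {δ | ∃ γ ∈ M, (X (indic H δ) : Γ → k) γ ≠ 0} ∈ H.orth.sets := fun _ hD =>
  ((hX.finite_entries hD hM).image Prod.fst).subset
    fun δ ⟨⟨γ, hγ, h⟩, hδ⟩ => ⟨(δ, γ), ⟨hδ, hγ, h⟩, rfl⟩

theorem finite_support_mul (hX : SigmaPreserving X) (f : bspace k E.orth) (δ : Δ) :
    (support fun γ => (f : Γ → k) γ * (X (indic H δ) : Γ → k) γ).Finite :=
  (hX.finite_column f.2 δ).subset fun _ h => ⟨left_ne_zero_of_mul h, right_ne_zero_of_mul h⟩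

/-- The adjoint of a `Σ`-preserving map, given by the transposed matrix. -/
noncomputable def adjoint (hX : SigmaPreserving X) : bspace k E.orth →ₗ[k] bspace k H.orth where
  toFun f := ⟨fun δ => pairing (f : Γ → k) (X (indic H δ) : Γ → k),
    H.orth.subset_mem _ _ (fun _ h => exists_ne_of_pairing_ne h) (hX.rows_mem_orth f.2)⟩
  map_add' f f' := by
    ext δ
    change pairing ((f : Γ → k) + (f' : Γ → k)) _ = pairing (f : Γ → k) _ + pairing (f' : Γ → k) _
    simp only [pairing]
    rw [← finsum_add_distrib (hX.finite_support_mul f δ) (hX.finite_support_mul f' δ)]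
    exact finsum_congr fun γ => add_mul ((f : Γ → k) γ) ((f' : Γ → k) γ) _
  map_smul' c f := by
    ext δ
    change pairing (c • (f : Γ → k)) _ = c * pairing (f : Γ → k) _
    simp only [pairing]
    rw [mul_finsum]
    exact finsum_congr fun γ => mul_assoc c ((f : Γ → k) γ) _

theorem adjoint_apply (hX : SigmaPreserving X) (f : bspace k E.orth) (δ : Δ) :
    (hX.adjoint f : Δ → k) δ = ∑ᶠ γ, (f : Γ → k) γ * (X (indic H δ) : Γ → k) γ := rfl

theorem pairing_adjoint (hX : SigmaPreserving X) (f : bspace k E.orth) (g : bspace k H) :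
    pairing (hX.adjoint f : Δ → k) (g : Δ → k) = pairing (f : Γ → k) (X g : Γ → k) := by
  have hfin := hX.finite_entries g.2 f.2
  calc pairing (hX.adjoint f : Δ → k) (g : Δ → k)
      = ∑ᶠ δ, ∑ᶠ γ, (f : Γ → k) γ * (X (indic H δ) : Γ → k) γ * (g : Δ → k) δ :=
        finsum_congr fun δ => by rw [adjoint_apply, finsum_mul]
    _ = ∑ᶠ γ, ∑ᶠ δ, (f : Γ → k) γ * (X (indic H δ) : Γ → k) γ * (g : Δ → k) δ :=
        finsum_swap_of_finite _ (hfin.subset fun p h =>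
          ⟨right_ne_zero_of_mul h, left_ne_zero_of_mul (left_ne_zero_of_mul h),
            right_ne_zero_of_mul (left_ne_zero_of_mul h)⟩)
    _ = pairing (f : Γ → k) (X g : Γ → k) := finsum_congr fun γ => by
        rw [hX.apply_eq_finsum, mul_finsum]
        exact finsum_congr fun δ => by ring

theorem sigmaPreserving_adjoint (hX : SigmaPreserving X) : SigmaPreserving hX.adjoint := by
  intro ι f hf
  have hcol := hX.finite_column hf.1
  have mem : ∀ {i γ}, (f i : Γ → k) γ ≠ 0 → γ ∈ ⋃ i, support (f i : Γ → k) := fun {i γ} h =>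
    Set.mem_iUnion.2 ⟨i, h⟩
  have hpairs : ∀ δ,
      {p : Γ × ι | (f p.2 : Γ → k) p.1 * (X (indic H δ) : Γ → k) p.1 ≠ 0}.Finite := by
    intro δ
    refine ((hcol δ).biUnion fun γ _ => (hf.2 γ).image fun i => (γ, i)).subset ?_
    rintro ⟨γ, i⟩ h
    refine Set.mem_biUnion (x := γ) ?_ ⟨i, left_ne_zero_of_mul h, rfl⟩
    exact ⟨mem (left_ne_zero_of_mul h), right_ne_zero_of_mul h⟩
  refine ⟨⟨H.orth.subset_mem _ _ (Set.iUnion_subset fun i δ h => ?_) (hX.rows_mem_orth hf.1),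
    fun δ => ?_⟩, ?_⟩
  · obtain ⟨γ, h₁, h₂⟩ := exists_ne_of_pairing_ne h
    exact ⟨γ, mem h₁, h₂⟩
  · refine ((hpairs δ).image Prod.snd).subset fun i h => ?_
    obtain ⟨γ, h₁, h₂⟩ := exists_ne_of_pairing_ne h
    exact ⟨(γ, i), mul_ne_zero h₁ h₂, rfl⟩
  · ext δ
    calc ∑ᶠ γ, (∑ᶠ i, (f i : Γ → k) γ) * (X (indic H δ) : Γ → k) γ
        = ∑ᶠ γ, ∑ᶠ i, (f i : Γ → k) γ * (X (indic H δ) : Γ → k) γ :=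
          finsum_congr fun γ => finsum_mul _ _
      _ = ∑ᶠ i, ∑ᶠ γ, (f i : Γ → k) γ * (X (indic H δ) : Γ → k) γ :=
          finsum_swap_of_finite _ (hpairs δ)

theorem exists_adjoint (hX : SigmaPreserving X) {E' : Borno Γ} {H' : Borno Δ}
    (hE : E.orth = E') (hH : H.orth = H') :
    ∃ Y : bspace k E' →ₗ[k] bspace k H', SigmaPreserving Y ∧
      ∀ (f : bspace k E') (g : bspace k H),
        pairing (Y f : Δ → k) (g : Δ → k) = pairing (f : Γ → k) (X g : Γ → k) := by
  subst hE hH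
  exact ⟨hX.adjoint, hX.sigmaPreserving_adjoint, hX.pairing_adjoint⟩

end SigmaPreserving

end Adjoint

/-- a linear map `S : k(Δ;G^⊥) → k(Γ;F^⊥)` is Σ-preserving iff it is the adjoint
`T^⊥` of some Σ-preserving `T : k(Γ;F^⊥⊥) → k(Δ;G^⊥⊥)`, i.e. iff there is a Σ-preserving `T`
with `⟨T f, g⟩ = ⟨f, S g⟩` for all `f` and `g`. -/
theorem stmt7 {k : Type} [Field k] {Γ Δ : Type} (F : Borno Γ) (G : Borno Δ)
    (S : bspace k G.orth →ₗ[k] bspace k F.orth) :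
    SigmaPreserving S ↔
      ∃ T : bspace k F.orth.orth →ₗ[k] bspace k G.orth.orth,
        SigmaPreserving T ∧
        ∀ (f : bspace k F.orth.orth) (g : bspace k G.orth),
          pairing ((T f : Δ → k)) ((g : Δ → k)) = pairing ((f : Γ → k)) ((S g : Γ → k)) := by
  refine ⟨fun hS => hS.exists_adjoint rfl rfl, ?_⟩
  rintro ⟨T, hT, hTS⟩
  obtain ⟨S', hS', hTS'⟩ := hT.exists_adjoint G.orth_orth_orth F.orth_orth_orth
  suffices S = S' from this ▸ hS'
  ext g γ
  rw [← pairing_indic F.orth.orth γ (S g : Γ → k), ← hTS, pairing_comm, ← hTS', pairing_comm,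
    pairing_indic]
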